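/- arXiv:0808.1025 — 4 statements merged into one kernel-verified Lean document; each statement's English description precedes it below -/
import Mathlib

section
/- Let λ > 0 and κ > 0. Suppose ρ̇ : (0, ∞) → ℝ satisfies ρ̇(t) → λ as t → 0⁺ and ρ̇(s) − ρ̇(t) ≤ κ(t − s) for all 0 < s < t (maximum concavity at most κ). Then ρ̇(t) ≥ λ − κt for all t > 0; in particular ρ̇(t) > 0 for all 0 < t < λ/κ, so any threshold T > 0 with ρ̇(T) = 0 satisfies T ≥ λ/κ. (Hence, given a fixed maximum concavity 1/γ, the MCP provides the smallest possible second threshold γλ for unbiasedness.) -/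
open Filter Topology

/-- If `ρ̇(t) → λ` as `t → 0⁺` and the maximum concavity is at most `κ`, then
`ρ̇(t) ≥ λ − κt` for all `t > 0`; in particular `ρ̇(t) > 0` on `(0, λ/κ)`, so any
threshold `T > 0` with `ρ̇(T) = 0` satisfies `T ≥ λ/κ`. -/
theorem mcp_smallest_unbiasedness_threshold
    (lam kap : ℝ) (hlam : 0 < lam) (hkap : 0 < kap)
    (rhoDot : ℝ → ℝ)
    (hlim : Tendsto rhoDot (nhdsWithin 0 (Set.Ioi 0)) (nhds lam))
    (hconc : ∀ s t : ℝ, 0 < s → s < t → rhoDot s - rhoDot t ≤ kap * (t - s)) :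
    (∀ t : ℝ, 0 < t → lam - kap * t ≤ rhoDot t) ∧
    (∀ t : ℝ, 0 < t → t < lam / kap → 0 < rhoDot t) ∧
    (∀ T : ℝ, 0 < T → rhoDot T = 0 → lam / kap ≤ T) := by
  have lower : ∀ t : ℝ, 0 < t → lam - kap * t ≤ rhoDot t := by
    intro t ht
    have hbound : ∀ᶠ s in 𝓝[>] (0 : ℝ), rhoDot s ≤ rhoDot t + kap * t := by
      filter_upwards [Ioo_mem_nhdsGT ht] with s hs
      nlinarith [hconc s t hs.1 hs.2, mul_pos hkap hs.1]
    linarith [le_of_tendsto hlim hbound]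
  have pos : ∀ t : ℝ, 0 < t → t < lam / kap → 0 < rhoDot t := by
    intro t ht htlt
    rw [lt_div_iff₀ hkap] at htlt
    linarith [lower t ht]
  refine ⟨lower, pos, fun T hT hzero => ?_⟩
  by_contra! hlt
  exact (pos T hT hlt).ne' hzero
end

section
/- Let y ∈ ℝⁿ, let X ∈ ℝ^{n×p}, and let ρ(·; λ) : [0, ∞) → ℝ and κ ≥ 0 be such that the map t ↦ ρ(|t|; λ) + κt²/2 is convex on ℝ. If κ < c_min(XᵀX/n), the smallest eigenvalue of XᵀX/n, then the penalized squared loss β ↦ ‖y − Xβ‖²/(2n) + Σ_{j=1}^p ρ(|β_j|; λ) is strictly convex on ℝ^p. (Global convexity condition κ(ρ; λ) < c_min(XᵀX/n) implies a strictly convex objective.) -/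
open Finset

/-- If every Rayleigh quotient infimum over the unit sphere exceeds `kap`, then the quadratic
form `v ↦ ‖Xv‖²/n` strictly dominates `kap ‖v‖²` away from the origin. -/
theorem mul_sum_sq_lt_of_lt_iInf_rayleigh {n p : ℕ} (X : Matrix (Fin n) (Fin p) ℝ) {kap : ℝ}
    (hcmin : kap < ⨅ v : {v : Fin p → ℝ // ∑ j, v j ^ 2 = 1},
        (∑ i, (X.mulVec (v : Fin p → ℝ)) i ^ 2) / n)
    {u : Fin p → ℝ} (hu : u ≠ 0) :
    kap * ∑ j, u j ^ 2 < (∑ i, (X.mulVec u) i ^ 2) / n := by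
  have hpos : 0 < ∑ j, u j ^ 2 := by
    obtain ⟨j, hj⟩ := Function.ne_iff.mp hu
    exact Finset.sum_pos' (fun i _ => sq_nonneg _) ⟨j, Finset.mem_univ j, sq_pos_of_ne_zero hj⟩
  set r := √(∑ j, u j ^ 2)
  have hr : r ^ 2 = ∑ j, u j ^ 2 := Real.sq_sqrt hpos.le
  have hr0 : r ^ 2 ≠ 0 := hr ▸ hpos.ne'
  have hunit : ∑ j, (r⁻¹ • u) j ^ 2 = 1 := by
    simp only [Pi.smul_apply, smul_eq_mul, mul_pow, ← Finset.mul_sum, ← hr, inv_pow]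
    exact inv_mul_cancel₀ hr0
  have hbdd : BddBelow (Set.range fun v : {v : Fin p → ℝ // ∑ j, v j ^ 2 = 1} =>
      (∑ i, (X.mulVec (v : Fin p → ℝ)) i ^ 2) / (n : ℝ)) := by
    refine ⟨0, ?_⟩
    rintro _ ⟨v, rfl⟩
    positivity
  have h := hcmin.trans_le (ciInf_le hbdd ⟨r⁻¹ • u, hunit⟩)
  simp only [Matrix.mulVec_smul, Pi.smul_apply, smul_eq_mul, mul_pow, ← Finset.mul_sum,
    inv_pow, hr] at h
  rwa [mul_div_assoc, inv_mul_eq_div, lt_div_iff₀ hpos] at h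

/-- Convexity of `t ↦ f t + kap t²/2` bounds the convexity defect of `f`. -/
theorem ConvexOn.le_add_of_add_sq {f : ℝ → ℝ} {kap : ℝ}
    (hf : ConvexOn ℝ Set.univ (fun t : ℝ => f t + kap * t ^ 2 / 2)) {a b : ℝ} (ha : 0 ≤ a)
    (hb : 0 ≤ b) (hab : a + b = 1) (s t : ℝ) :
    f (a * s + b * t) ≤ a * f s + b * f t + a * b / 2 * (kap * (s - t) ^ 2) := by
  have h := hf.2 (Set.mem_univ s) (Set.mem_univ t) ha hb hab
  simp only [smul_eq_mul] at h
  obtain rfl : b = 1 - a := by linarith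
  linarith

/-- The exact convexity defect of a sum of squared residuals. -/
theorem sum_sq_sub_mulVec_convex_comb {m k : Type*} [Fintype m] [Fintype k] (y : m → ℝ)
    (X : Matrix m k ℝ) (u v : k → ℝ) {a b : ℝ} (hab : a + b = 1) :
    ∑ i, (y i - X.mulVec (a • u + b • v) i) ^ 2 =
      a * ∑ i, (y i - X.mulVec u i) ^ 2 + b * ∑ i, (y i - X.mulVec v i) ^ 2
        - a * b * ∑ i, X.mulVec (u - v) i ^ 2 := by
  simp only [Finset.mul_sum, ← Finset.sum_add_distrib, ← Finset.sum_sub_distrib]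
  refine Finset.sum_congr rfl fun i _ => ?_
  obtain rfl : b = 1 - a := by linarith
  simp only [Matrix.mulVec_add, Matrix.mulVec_sub, Matrix.mulVec_smul, Pi.add_apply,
    Pi.sub_apply, Pi.smul_apply, smul_eq_mul]
  ring

/-- If `t ↦ ρ(|t|; λ) + κt²/2` is convex and `κ` is smaller than the smallest
eigenvalue of `XᵀX/n` (expressed as the infimum of the Rayleigh quotient over the
unit sphere), then the penalized squared loss
`β ↦ ‖y − Xβ‖²/(2n) + Σⱼ ρ(|βⱼ|; λ)` is strictly convex on `ℝᵖ`. -/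
theorem global_convexity_implies_strictly_convex_objective
    (n p : ℕ) (hn : 0 < n)
    (y : Fin n → ℝ) (X : Matrix (Fin n) (Fin p) ℝ)
    (rho : ℝ → ℝ) (kap : ℝ) (hkap : 0 ≤ kap)
    (hconv : ConvexOn ℝ Set.univ (fun t : ℝ => rho |t| + kap * t ^ 2 / 2))
    (hcmin : kap < ⨅ v : {v : Fin p → ℝ // ∑ j, v j ^ 2 = 1},
        (∑ i, (X.mulVec (v : Fin p → ℝ)) i ^ 2) / n) :
    StrictConvexOn ℝ Set.univ
      (fun beta : Fin p → ℝ =>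
        (∑ i, (y i - X.mulVec beta i) ^ 2) / (2 * n) + ∑ j, rho |beta j|) := by
  refine ⟨convex_univ, fun u _ v _ huv a b ha hb hab => ?_⟩
  have hquad := mul_sum_sq_lt_of_lt_iInf_rayleigh X hcmin (sub_ne_zero.mpr huv)
  have hpen : ∑ j, rho |(a • u + b • v) j| ≤ a * ∑ j, rho |u j| + b * ∑ j, rho |v j|
      + a * b / 2 * (kap * ∑ j, (u - v) j ^ 2) := by
    simp only [Finset.mul_sum, ← Finset.sum_add_distrib]
    exact Finset.sum_le_sum fun j _ =>
      ConvexOn.le_add_of_add_sq (f := fun t => rho |t|) hconv ha.le hb.le hab (u j) (v j)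
  have hgap := mul_lt_mul_of_pos_left hquad (half_pos (mul_pos ha hb))
  simp only [smul_eq_mul]
  rw [sum_sq_sub_mulVec_convex_comb y X u v hab]
  have hn' : (n : ℝ) ≠ 0 := Nat.cast_ne_zero.mpr hn.ne'
  generalize ∑ i, (y i - X.mulVec u i) ^ 2 = A
  generalize ∑ i, (y i - X.mulVec v i) ^ 2 = B
  generalize ∑ i, X.mulVec (u - v) i ^ 2 = C at hgap ⊢
  have hsplit : (a * A + b * B - a * b * C) / (2 * n)
      = a * (A / (2 * n)) + b * (B / (2 * n)) - a * b / 2 * (C / n) := by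
    field_simp
  rw [hsplit]
  linarith
end

section
/- Let A ⊆ {1, …, p} with rank(X_A) = |A|, and let ρ(·; λ) : [0, ∞) → [0, ∞) be continuous with ρ(0; λ) = 0 and nondecreasing, such that for some κ < c_min(X_AᵀX_A/n) the map t ↦ ρ(|t|; λ) + κt²/2 is convex on ℝ. Then for every y ∈ ℝⁿ the restricted penalized loss β_A ↦ ‖y − X_A β_A‖²/(2n) + Σ_{j∈A} ρ(|β_j|; λ) has a unique global minimizer β̂_A(y), and the map y ↦ β̂_A(y) is continuous on ℝⁿ. -/
open Finset

section PenalizedLeastSquares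

variable {m ι : Type*} [Fintype m] [Fintype ι]

/-- The least squares loss `‖y - M b‖² / (2n)` plus the separable penalty `∑ ρ(|b j|)`. -/
noncomputable def penalizedLoss (n : ℝ) (M : Matrix m ι ℝ) (rho : ℝ → ℝ) (y : m → ℝ)
    (b : ι → ℝ) : ℝ :=
  (∑ i, (y i - M.mulVec b i) ^ 2) / (2 * n) + ∑ j, rho |b j|

/-- The infimum of the normalized quadratic form over the unit sphere bounds it everywhere. -/
theorem iInf_sphere_mul_le (n : ℝ) (hn : 0 ≤ n) (M : Matrix m ι ℝ) (v : ι → ℝ) :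
    (⨅ v : {v : ι → ℝ // ∑ j, v j ^ 2 = 1}, (∑ i, M.mulVec (v : ι → ℝ) i ^ 2) / n)
      * ∑ j, v j ^ 2 ≤ (∑ i, M.mulVec v i ^ 2) / n := by
  have hs : 0 ≤ ∑ j, v j ^ 2 := sum_nonneg fun j _ => sq_nonneg _
  have hr : 0 ≤ (∑ i, M.mulVec v i ^ 2) / n :=
    div_nonneg (sum_nonneg fun j _ => sq_nonneg _) hn
  rcases hs.eq_or_lt with h | h
  · rw [← h, mul_zero]
    exact hr
  · have hsq := Real.sq_sqrt hs
    have hunit : ∑ j, ((Real.sqrt (∑ j, v j ^ 2))⁻¹ • v) j ^ 2 = 1 := by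
      simp only [Pi.smul_apply, smul_eq_mul, mul_pow, ← mul_sum, inv_pow, hsq]
      exact inv_mul_cancel₀ h.ne'
    have hbdd : BddBelow (Set.range fun v : {v : ι → ℝ // ∑ j, v j ^ 2 = 1} =>
        (∑ i, M.mulVec (v : ι → ℝ) i ^ 2) / n) := by
      refine ⟨0, ?_⟩
      rintro _ ⟨w, rfl⟩
      exact div_nonneg (sum_nonneg fun j _ => sq_nonneg _) hn
    have hle := ciInf_le hbdd ⟨_, hunit⟩
    simp only [Matrix.mulVec_smul, Pi.smul_apply, smul_eq_mul, mul_pow, ← mul_sum, inv_pow,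
      hsq] at hle
    refine (mul_le_mul_of_nonneg_right hle hs).trans_eq ?_
    field_simp

theorem norm_sq_le_sum_sq (v : ι → ℝ) : ‖v‖ ^ 2 ≤ ∑ j, v j ^ 2 := by
  have hs : 0 ≤ ∑ j, v j ^ 2 := sum_nonneg fun j _ => sq_nonneg _
  have h : ‖v‖ ≤ Real.sqrt (∑ j, v j ^ 2) := by
    refine (pi_norm_le_iff_of_nonneg (Real.sqrt_nonneg _)).2 fun j => ?_
    rw [Real.norm_eq_abs]
    refine Real.abs_le_sqrt ?_
    exact single_le_sum (f := fun j => v j ^ 2) (fun j _ => sq_nonneg _) (mem_univ j)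
  calc ‖v‖ ^ 2 ≤ Real.sqrt (∑ j, v j ^ 2) ^ 2 := by gcongr
    _ = _ := Real.sq_sqrt hs

theorem sum_mul_mulVec_le (M : Matrix m ι ℝ) (x : m → ℝ) (v : ι → ℝ) :
    ∑ i, x i * M.mulVec v i ≤ (∑ i, ∑ j, |M i j|) * ‖x‖ * ‖v‖ := by
  simp only [Matrix.mulVec, dotProduct, mul_sum, sum_mul]
  refine sum_le_sum fun i _ => sum_le_sum fun j _ => ?_
  refine (le_abs_self _).trans ?_
  rw [abs_mul, abs_mul, mul_left_comm, mul_assoc]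
  gcongr
  · exact norm_le_pi_norm x i
  · exact norm_le_pi_norm v j

theorem midpoint_le_of_convexOn_add_sq {f : ℝ → ℝ} {k : ℝ}
    (hf : ConvexOn ℝ Set.univ fun t => f t + k * t ^ 2 / 2) (a b : ℝ) :
    f ((a + b) / 2) ≤ f a / 2 + f b / 2 + k / 8 * (a - b) ^ 2 := by
  have h := hf.2 (Set.mem_univ a) (Set.mem_univ b)
    one_half_pos.le one_half_pos.le (add_halves 1)
  simp only [smul_eq_mul] at h
  rw [show 1 / 2 * a + 1 / 2 * b = (a + b) / 2 by ring] at h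
  linarith

variable {n : ℝ} {M : Matrix m ι ℝ} {rho : ℝ → ℝ} {k mu : ℝ}

/-- Midpoint strong convexity of the penalized loss. -/
theorem penalizedLoss_midpoint_le
    (hconv : ConvexOn ℝ Set.univ fun t : ℝ => rho |t| + k * t ^ 2 / 2)
    (hmu : ∀ v : ι → ℝ, mu * ∑ j, v j ^ 2 ≤ (∑ i, M.mulVec v i ^ 2) / n)
    (y : m → ℝ) (u w : ι → ℝ) :
    penalizedLoss n M rho y ((1 / 2 : ℝ) • (u + w)) ≤
      penalizedLoss n M rho y u / 2 + penalizedLoss n M rho y w / 2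
        - (mu - k) / 8 * ∑ j, (u j - w j) ^ 2 := by
  have hpen : ∑ j, rho |((1 / 2 : ℝ) • (u + w)) j| ≤
      (∑ j, rho |u j|) / 2 + (∑ j, rho |w j|) / 2 + k / 8 * ∑ j, (u j - w j) ^ 2 := by
    rw [sum_div, sum_div, mul_sum, ← sum_add_distrib, ← sum_add_distrib]
    refine sum_le_sum fun j _ => ?_
    have h := midpoint_le_of_convexOn_add_sq (f := fun t => rho |t|) hconv (u j) (w j)
    rwa [Pi.smul_apply, Pi.add_apply, smul_eq_mul,
      show 1 / 2 * (u j + w j) = (u j + w j) / 2 by ring]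
  have hquad : ∑ i, (y i - M.mulVec ((1 / 2 : ℝ) • (u + w)) i) ^ 2 =
      (∑ i, (y i - M.mulVec u i) ^ 2) / 2 + (∑ i, (y i - M.mulVec w i) ^ 2) / 2
        - (∑ i, M.mulVec (u - w) i ^ 2) / 4 := by
    rw [sum_div, sum_div, sum_div, ← sum_add_distrib, ← sum_sub_distrib]
    refine sum_congr rfl fun i _ => ?_
    simp only [Matrix.mulVec_smul, Matrix.mulVec_add, Matrix.mulVec_sub, Pi.smul_apply,
      Pi.add_apply, Pi.sub_apply, smul_eq_mul]
    ring
  have h := hmu (u - w)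
  simp only [Pi.sub_apply] at h
  unfold penalizedLoss
  rw [hquad]
  have e : ∀ a b c : ℝ, (a / 2 + b / 2 - c / 4) / (2 * n) =
      a / (2 * n) / 2 + b / (2 * n) / 2 - c / n / 8 := fun a b c => by ring
  rw [e]
  linarith

theorem continuous_penalizedLoss (hcont : ContinuousOn rho (Set.Ici 0)) (y : m → ℝ) :
    Continuous (penalizedLoss n M rho y) := by
  have hr : Continuous fun t : ℝ => rho |t| :=
    hcont.comp_continuous continuous_abs fun t => abs_nonneg t
  have hm : Continuous fun b : ι → ℝ => M.mulVec b := by fun_prop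
  unfold penalizedLoss
  refine Continuous.add ?_ (continuous_finsetSum _ fun j _ => hr.comp (continuous_apply j))
  refine Continuous.div_const (continuous_finsetSum _ fun i _ => ?_) _
  exact (continuous_const.sub ((continuous_apply i).comp hm)).pow 2

theorem penalizedLoss_nonneg (hn : 0 ≤ n) (hrho : ∀ t : ℝ, 0 ≤ t → 0 ≤ rho t) (y : m → ℝ)
    (b : ι → ℝ) : 0 ≤ penalizedLoss n M rho y b :=
  add_nonneg (div_nonneg (sum_nonneg fun _ _ => sq_nonneg _) (by positivity))
    (sum_nonneg fun _ _ => hrho _ (abs_nonneg _))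

theorem exists_penalizedLoss_minimizer (hn : 0 ≤ n)
    (hcont : ContinuousOn rho (Set.Ici 0)) (hrho : ∀ t : ℝ, 0 ≤ t → 0 ≤ rho t)
    (hconv : ConvexOn ℝ Set.univ fun t : ℝ => rho |t| + k * t ^ 2 / 2)
    (hmu : ∀ v : ι → ℝ, mu * ∑ j, v j ^ 2 ≤ (∑ i, M.mulVec v i ^ 2) / n)
    (hk : k < mu) (y : m → ℝ) :
    ∃ u, ∀ b, penalizedLoss n M rho y u ≤ penalizedLoss n M rho y b := by
  refine (continuous_penalizedLoss hcont y).exists_forall_le ?_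
  have hgrow : ∀ b : ι → ℝ, (mu - k) / 4 * ‖b‖ ^ 2 + -penalizedLoss n M rho y 0 ≤
      penalizedLoss n M rho y b := fun b => by
    have h := penalizedLoss_midpoint_le hconv hmu y b 0
    have h0 := penalizedLoss_nonneg (M := M) hn hrho y ((1 / 2 : ℝ) • (b + 0))
    simp only [Pi.zero_apply, sub_zero] at h
    have := mul_le_mul_of_nonneg_left (norm_sq_le_sum_sq b) (sub_pos.2 hk).le
    linarith
  refine Filter.tendsto_atTop_mono hgrow ?_
  refine Filter.tendsto_atTop_add_const_right _ _ ?_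
  refine Filter.Tendsto.const_mul_atTop (by linarith) ?_
  exact (Filter.tendsto_pow_atTop two_ne_zero).comp (tendsto_norm_cocompact_atTop (E := ι → ℝ))

/-- Quadratic growth of the penalized loss around a minimizer. -/
theorem penalizedLoss_add_le_of_minimizer
    (hconv : ConvexOn ℝ Set.univ fun t : ℝ => rho |t| + k * t ^ 2 / 2)
    (hmu : ∀ v : ι → ℝ, mu * ∑ j, v j ^ 2 ≤ (∑ i, M.mulVec v i ^ 2) / n)
    (hk : k < mu) {y : m → ℝ} {u : ι → ℝ}
    (hu : ∀ b, penalizedLoss n M rho y u ≤ penalizedLoss n M rho y b) (b : ι → ℝ) :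
    penalizedLoss n M rho y u + (mu - k) / 4 * ‖u - b‖ ^ 2 ≤ penalizedLoss n M rho y b := by
  have h := penalizedLoss_midpoint_le hconv hmu y u b
  have hmid := hu ((1 / 2 : ℝ) • (u + b))
  have := mul_le_mul_of_nonneg_left (norm_sq_le_sum_sq (u - b)) (sub_pos.2 hk).le
  simp only [Pi.sub_apply] at this
  linarith

theorem penalizedLoss_cross_difference (y z : m → ℝ) (u w : ι → ℝ) :
    penalizedLoss n M rho y w - penalizedLoss n M rho y u
      + (penalizedLoss n M rho z u - penalizedLoss n M rho z w) =
      (∑ i, (y - z) i * M.mulVec (u - w) i) / n := by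
  have h : ∑ i, (y - z) i * M.mulVec (u - w) i =
      (∑ i, (y i - M.mulVec w i) ^ 2 - ∑ i, (y i - M.mulVec u i) ^ 2
        + (∑ i, (z i - M.mulVec u i) ^ 2 - ∑ i, (z i - M.mulVec w i) ^ 2)) / 2 := by
    rw [← sum_sub_distrib, ← sum_sub_distrib, ← sum_add_distrib, sum_div]
    refine sum_congr rfl fun i _ => ?_
    simp only [Matrix.mulVec_sub, Pi.sub_apply]
    ring
  rw [h]
  unfold penalizedLoss
  ring

/-- Any selection of minimizers of the penalized loss is continuous in the response vector. -/
theorem continuous_of_penalizedLoss_minimizer (hn : 0 ≤ n)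
    (hconv : ConvexOn ℝ Set.univ fun t : ℝ => rho |t| + k * t ^ 2 / 2)
    (hmu : ∀ v : ι → ℝ, mu * ∑ j, v j ^ 2 ≤ (∑ i, M.mulVec v i ^ 2) / n)
    (hk : k < mu) {f : (m → ℝ) → ι → ℝ}
    (hf : ∀ y b, penalizedLoss n M rho y (f y) ≤ penalizedLoss n M rho y b) :
    Continuous f := by
  have hd : 0 < (mu - k) / 2 := by linarith
  have hC : 0 ≤ (∑ i, ∑ j, |M i j|) / n :=
    div_nonneg (sum_nonneg fun _ _ => sum_nonneg fun _ _ => abs_nonneg _) hn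
  refine (LipschitzWith.of_dist_le_mul
    (K := Real.toNNReal ((∑ i, ∑ j, |M i j|) / n / ((mu - k) / 2))) fun y z => ?_).continuous
  rw [Real.coe_toNNReal _ (div_nonneg hC hd.le), dist_eq_norm, dist_eq_norm, div_mul_eq_mul_div,
    le_div_iff₀ hd]
  have h1 := penalizedLoss_add_le_of_minimizer hconv hmu hk (hf y) (f z)
  have h2 := penalizedLoss_add_le_of_minimizer hconv hmu hk (hf z) (f y)
  rw [norm_sub_rev] at h2
  have h3 := penalizedLoss_cross_difference (n := n) (M := M) (rho := rho) y z (f y) (f z)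
  have h4 := div_le_div_of_nonneg_right (sum_mul_mulVec_le M (y - z) (f y - f z)) hn
  have h5 : (mu - k) / 2 * ‖f y - f z‖ ^ 2 ≤
      (∑ i, ∑ j, |M i j|) / n * ‖y - z‖ * ‖f y - f z‖ := by
    have e : (∑ i, ∑ j, |M i j|) * ‖y - z‖ * ‖f y - f z‖ / n =
        (∑ i, ∑ j, |M i j|) / n * ‖y - z‖ * ‖f y - f z‖ := by ring
    linarith
  rcases (norm_nonneg (f y - f z)).eq_or_lt with h | h
  · rw [← h, zero_mul]
    positivity
  · exact le_of_mul_le_mul_right (by linarith) h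

end PenalizedLeastSquares

/-- Under `rank(X_A) = |A|` and the convexity condition `κ < c_min(X_AᵀX_A/n)`
(with `t ↦ ρ(|t|;λ) + κt²/2` convex, `ρ` continuous, nondecreasing and `ρ(0)=0`),
the restricted penalized loss has a unique global minimizer `β̂_A(y)` for every `y`,
and `y ↦ β̂_A(y)` is continuous. -/
theorem restricted_minimizer_exists_unique_and_continuous
    (n p : ℕ) (hn : 0 < n)
    (X : Matrix (Fin n) (Fin p) ℝ) (A : Finset (Fin p))
    (hrank : (X.submatrix id (fun j : {j // j ∈ A} => (j : Fin p))).rank = A.card)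
    (rho : ℝ → ℝ) (kap : ℝ)
    (hrho_cont : ContinuousOn rho (Set.Ici 0))
    (hrho_zero : rho 0 = 0)
    (hrho_nonneg : ∀ t : ℝ, 0 ≤ t → 0 ≤ rho t)
    (hrho_mono : MonotoneOn rho (Set.Ici 0))
    (hconv : ConvexOn ℝ Set.univ (fun t : ℝ => rho |t| + kap * t ^ 2 / 2))
    (hcmin : kap < ⨅ v : {v : {j // j ∈ A} → ℝ // ∑ j, v j ^ 2 = 1},
        (∑ i, ((X.submatrix id (fun j : {j // j ∈ A} => (j : Fin p))).mulVec
          (v : {j // j ∈ A} → ℝ)) i ^ 2) / n) :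
    ∃ betaHat : (Fin n → ℝ) → ({j // j ∈ A} → ℝ),
      Continuous betaHat ∧
      ∀ y : Fin n → ℝ, ∀ b : {j // j ∈ A} → ℝ, b ≠ betaHat y →
        (∑ i, (y i - (X.submatrix id (fun j : {j // j ∈ A} => (j : Fin p))).mulVec
            (betaHat y) i) ^ 2) / (2 * n) + ∑ j, rho |betaHat y j|
        < (∑ i, (y i - (X.submatrix id (fun j : {j // j ∈ A} => (j : Fin p))).mulVec
            b i) ^ 2) / (2 * n) + ∑ j, rho |b j| := by
  have hn0 : (0 : ℝ) ≤ n := n.cast_nonneg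
  have hmu := iInf_sphere_mul_le (n : ℝ) hn0
    (X.submatrix id (fun j : {j // j ∈ A} => (j : Fin p)))
  choose f hf using exists_penalizedLoss_minimizer hn0 hrho_cont hrho_nonneg hconv hmu hcmin
  refine ⟨f, continuous_of_penalizedLoss_minimizer hn0 hconv hmu hcmin hf, fun y b hb => ?_⟩
  have h := penalizedLoss_add_le_of_minimizer hconv hmu hcmin (hf y) b
  have hpos : 0 < ‖f y - b‖ := norm_pos_iff.2 (sub_ne_zero.2 hb.symm)
  exact (lt_add_of_pos_right _
    (mul_pos (div_pos (sub_pos.2 hcmin) four_pos) (pow_pos hpos 2))).trans_le h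
end

section
/- Let λ > 0 and γ > 1, let z ∈ ℝ with |z| > γλ, and consider the scalar penalized loss f(t) = (z − t)²/2 + ρ(|t|; λ, γ) where ρ is the MCP. Then t = z is the unique global minimizer of f over ℝ, with minimum value f(z) = γλ²/2. Hence the MCP estimator is exactly unbiased beyond the second threshold γλ in the orthonormal (scalar) case. -/
theorem integral_max_one_sub_div_of_le {c s : ℝ} (hc : 0 < c) (hs : 0 ≤ s) (hsc : s ≤ c) :
    ∫ x in (0 : ℝ)..s, max (1 - x / c) 0 = s - s ^ 2 / (2 * c) := by
  have h : ∫ x in (0 : ℝ)..s, max (1 - x / c) 0 = ∫ x in (0 : ℝ)..s, (1 - x / c) := by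
    refine intervalIntegral.integral_congr fun x hx => ?_
    rw [Set.uIcc_of_le hs] at hx
    exact max_eq_left (sub_nonneg.2 ((div_le_one hc).2 (hx.2.trans hsc)))
  rw [h, intervalIntegral.integral_sub (by simp)
    (Continuous.intervalIntegrable (by fun_prop) _ _), intervalIntegral.integral_div]
  simp only [intervalIntegral.integral_const, integral_id, smul_eq_mul]
  field_simp
  ring

theorem integral_max_one_sub_div_of_ge {c s : ℝ} (hc : 0 < c) (hcs : c ≤ s) :
    ∫ x in (0 : ℝ)..s, max (1 - x / c) 0 = c / 2 := by
  have hcont : Continuous fun x : ℝ => max (1 - x / c) 0 := by fun_prop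
  have h : ∫ x in c..s, max (1 - x / c) 0 = ∫ _x in c..s, (0 : ℝ) := by
    refine intervalIntegral.integral_congr fun x hx => ?_
    rw [Set.uIcc_of_le hcs] at hx
    exact max_eq_right (sub_nonpos.2 ((one_le_div hc).2 hx.1))
  rw [← intervalIntegral.integral_add_adjacent_intervals
    (hcont.intervalIntegrable 0 c) (hcont.intervalIntegrable c s), h,
    integral_max_one_sub_div_of_le hc hc.le le_rfl, intervalIntegral.integral_zero]
  field_simp
  ring

/-- For the scalar MCP-penalized loss `f(t) = (z − t)²/2 + ρ(|t|; λ, γ)` with `γ > 1`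
and `|z| > γλ`, `t = z` is the unique global minimizer, and `f(z) = γλ²/2`:
the MCP is exactly unbiased beyond the second threshold `γλ`. -/
theorem mcp_scalar_unbiased_beyond_second_threshold
    (lam gam z : ℝ) (hlam : 0 < lam) (hgam : 1 < gam) (hz : gam * lam < |z|)
    (f : ℝ → ℝ)
    (hf : ∀ t : ℝ, f t = (z - t) ^ 2 / 2
      + lam * ∫ x in (0 : ℝ)..|t|, max (1 - x / (gam * lam)) 0) :
    (∀ t : ℝ, t ≠ z → f z < f t) ∧ f z = gam * lam ^ 2 / 2 := by
  have hc : 0 < gam * lam := by positivity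
  have hfz : f z = gam * lam ^ 2 / 2 := by
    rw [hf, integral_max_one_sub_div_of_ge hc hz.le]
    ring
  refine ⟨fun t ht => ?_, hfz⟩
  rw [hfz, hf]
  rcases le_total |t| (gam * lam) with h | h
  · rw [integral_max_one_sub_div_of_le hc (abs_nonneg t) h]
    have hpen : lam * (|t| - |t| ^ 2 / (2 * (gam * lam)))
        = gam * lam ^ 2 / 2 - (gam * lam - |t|) ^ 2 / (2 * gam) := by
      field_simp
      ring
    have hdist : (gam * lam - |t|) ^ 2 < (z - t) ^ 2 := by
      rw [← sq_abs (z - t)]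
      have := abs_sub_abs_le_abs_sub z t
      exact pow_lt_pow_left₀ (by linarith) (by linarith) two_ne_zero
    have hgam_le : (gam * lam - |t|) ^ 2 / (2 * gam) ≤ (gam * lam - |t|) ^ 2 / 2 :=
      div_le_div_of_nonneg_left (sq_nonneg _) two_pos (by linarith)
    rw [hpen]
    linarith
  · rw [integral_max_one_sub_div_of_ge hc h]
    have : 0 < (z - t) ^ 2 := sq_pos_of_ne_zero (sub_ne_zero.2 ht.symm)
    linarith
end
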